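/- Let ≺ be a length admissible order on FreeMonoid σ, let T be a set of words of length 2, and let N be the set of words having no factor in T. Let I be a two-sided ideal of A = FreeAlgebra K σ generated by homogeneous elements. Then the ideal generated by tip(I) equals the ideal generated by T if and only if nontip(I) = N; and in that case the images of the words in N under the quotient map form a K-basis of A/I, and the reduced Gröbner basis of I consists of homogeneous elements of degree 2 (so A/I is a strong Koszul algebra). -/

import Mathlib

open scoped TensorProduct

noncomputable section

/-- The embedding of words into the free algebra, sending a word to the product of the
corresponding generators. -/
def wordEmb (K : Type*) [Field K] (σ : Type*) : FreeMonoid σ →* FreeAlgebra K σ :=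
  FreeMonoid.lift (FreeAlgebra.ι K)

/-- The coefficient function of an element of the free algebra with respect to the word basis. -/
def coeffw (K : Type*) [Field K] (σ : Type*) (x : FreeAlgebra K σ) : FreeMonoid σ →₀ K :=
  (FreeAlgebra.basisFreeMonoid K σ).repr x

/-- A `K`-submodule of the free algebra is a two-sided ideal if it is closed under
left and right multiplication by arbitrary elements. -/
def IsIdeal2 (K : Type*) [Field K] (σ : Type*) (I : Submodule K (FreeAlgebra K σ)) : Prop :=
  ∀ a b : FreeAlgebra K σ, ∀ x ∈ I, a * x * b ∈ I

/-- The two-sided ideal generated by a set `S`. -/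
def idealGen (K : Type*) [Field K] (σ : Type*) (S : Set (FreeAlgebra K σ)) :
    Submodule K (FreeAlgebra K σ) :=
  Submodule.span K {x | ∃ a s b, s ∈ S ∧ x = a * s * b}

/-- `lt` is an admissible order on `FreeMonoid σ`: a well-order compatible with
multiplication on both sides, and such that a word is ≤ any word containing it as a factor. -/
structure IsAdmissibleOrder {σ : Type*} (lt : FreeMonoid σ → FreeMonoid σ → Prop) : Prop where
  isWellOrder : IsWellOrder (FreeMonoid σ) lt
  mul_right : ∀ p q r : FreeMonoid σ, lt p q → lt (p * r) (q * r)
  mul_left : ∀ p q s : FreeMonoid σ, lt p q → lt (s * p) (s * q)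
  le_mul : ∀ q r s : FreeMonoid σ, q = r * q * s ∨ lt q (r * q * s)

/-- A length admissible order is an admissible order in which longer words are larger. -/
structure IsLengthAdmissibleOrder {σ : Type*} (lt : FreeMonoid σ → FreeMonoid σ → Prop)
    extends IsAdmissibleOrder lt : Prop where
  length_lt : ∀ p q : FreeMonoid σ, p.length < q.length → lt p q

/-- `t` is the tip (the largest word of the support with respect to `lt`) of `x`. -/
def IsTipOf (K : Type*) [Field K] {σ : Type*} (lt : FreeMonoid σ → FreeMonoid σ → Prop)
    (t : FreeMonoid σ) (x : FreeAlgebra K σ) : Prop :=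
  coeffw K σ x t ≠ 0 ∧ ∀ u, coeffw K σ x u ≠ 0 → u = t ∨ lt u t

/-- The set of tips of the nonzero elements of `S`. -/
def tipSet (K : Type*) [Field K] {σ : Type*} (lt : FreeMonoid σ → FreeMonoid σ → Prop)
    (S : Set (FreeAlgebra K σ)) : Set (FreeMonoid σ) :=
  {t | ∃ x ∈ S, IsTipOf K lt t x}

/-- The set of nontips of `S`: words which are not a tip of an element of `S`. -/
def nontipSet (K : Type*) [Field K] {σ : Type*} (lt : FreeMonoid σ → FreeMonoid σ → Prop)
    (S : Set (FreeAlgebra K σ)) : Set (FreeMonoid σ) :=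
  {w | w ∉ tipSet K lt S}

/-- `G` is a Gröbner basis of the two-sided ideal `I` with respect to `lt`. -/
def IsGrobnerBasis (K : Type*) [Field K] {σ : Type*}
    (lt : FreeMonoid σ → FreeMonoid σ → Prop) (G : Set (FreeAlgebra K σ))
    (I : Submodule K (FreeAlgebra K σ)) : Prop :=
  G ⊆ ↑I ∧ idealGen K σ (wordEmb K σ '' tipSet K lt G) = idealGen K σ (wordEmb K σ '' tipSet K lt ↑I)

/-- `x` is homogeneous of degree `d`: every word in its support has length `d`. -/
def IsHomogOfDeg (K : Type*) [Field K] {σ : Type*} (x : FreeAlgebra K σ) (d : ℕ) : Prop :=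
  ∀ w : FreeMonoid σ, coeffw K σ x w ≠ 0 → w.length = d


theorem wordEmb_eq_basis (K : Type*) [Field K] (σ : Type*) (w : FreeMonoid σ) :
    wordEmb K σ w = FreeAlgebra.basisFreeMonoid K σ w := by
  simp [wordEmb, FreeAlgebra.basisFreeMonoid, FreeAlgebra.equivMonoidAlgebraFreeMonoid]

theorem coeffw_wordEmb (K : Type*) [Field K] (σ : Type*) (w : FreeMonoid σ) :
    coeffw K σ (wordEmb K σ w) = Finsupp.single w 1 := by
  rw [wordEmb_eq_basis, coeffw, Module.Basis.repr_self]

theorem mem_wordSpan (K : Type*) [Field K] (σ : Type*) (W : Set (FreeMonoid σ))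
    (x : FreeAlgebra K σ) :
    x ∈ Submodule.span K (wordEmb K σ '' W) ↔ ∀ w, coeffw K σ x w ≠ 0 → w ∈ W := by
  have : (wordEmb K σ '' W) = (FreeAlgebra.basisFreeMonoid K σ) '' W :=
    Set.image_congr fun w _ => wordEmb_eq_basis K σ w
  rw [this, Module.Basis.mem_span_image]
  simp only [Set.subset_def, Finset.mem_coe, Finsupp.mem_support_iff]
  rfl

theorem wordEmb_mem_wordSpan (K : Type*) [Field K] (σ : Type*) (W : Set (FreeMonoid σ))
    (w : FreeMonoid σ) :
    wordEmb K σ w ∈ Submodule.span K (wordEmb K σ '' W) ↔ w ∈ W := by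
  classical
  rw [mem_wordSpan, coeffw_wordEmb]
  constructor
  · intro h; exact h w (by simp)
  · intro h u hu
    by_cases e : w = u
    · exact e ▸ h
    · simp [Finsupp.single_apply, e] at hu

theorem mem_top_wordSpan (K : Type*) [Field K] (σ : Type*) (x : FreeAlgebra K σ) :
    x ∈ Submodule.span K (wordEmb K σ '' Set.univ) :=
  (mem_wordSpan K σ _ x).2 fun _ _ => Set.mem_univ _

theorem mul_mem_of_words (K : Type*) [Field K] (σ : Type*) (M : Submodule K (FreeAlgebra K σ))
    (x : FreeAlgebra K σ) (h : ∀ p q, wordEmb K σ p * x * wordEmb K σ q ∈ M)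
    (a b : FreeAlgebra K σ) : a * x * b ∈ M := by
  have h1 : ∀ p, wordEmb K σ p * x * b ∈ M := by
    intro p
    induction mem_top_wordSpan K σ b using Submodule.span_induction with
    | mem y hy => obtain ⟨q, -, rfl⟩ := hy; exact h p q
    | zero => simp
    | add y z _ _ hy hz => rw [mul_add]; exact M.add_mem hy hz
    | smul c y _ hy => rw [mul_smul_comm]; exact M.smul_mem c hy
  induction mem_top_wordSpan K σ a using Submodule.span_induction with
  | mem y hy => obtain ⟨q, -, rfl⟩ := hy; exact h1 q
  | zero => simp
  | add y z _ _ hy hz => rw [add_mul, add_mul]; exact M.add_mem hy hz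
  | smul c y _ hy => rw [smul_mul_assoc, smul_mul_assoc]; exact M.smul_mem c hy

/-- Words having a factor in `W`. -/
def factClosure {σ : Type*} (W : Set (FreeMonoid σ)) : Set (FreeMonoid σ) :=
  {w | ∃ t ∈ W, ∃ p q : FreeMonoid σ, w = p * t * q}

theorem idealGen_words (K : Type*) [Field K] (σ : Type*) (W : Set (FreeMonoid σ)) :
    idealGen K σ (wordEmb K σ '' W) = Submodule.span K (wordEmb K σ '' factClosure W) := by
  apply le_antisymm
  · refine Submodule.span_le.2 ?_
    rintro _ ⟨a, _, b, ⟨w, hw, rfl⟩, rfl⟩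
    refine mul_mem_of_words K σ _ _ (fun p q => ?_) a b
    rw [← map_mul, ← map_mul]
    exact Submodule.subset_span ⟨_, ⟨w, hw, p, q, rfl⟩, rfl⟩
  · refine Submodule.span_le.2 ?_
    rintro _ ⟨_, ⟨w, hw, p, q, rfl⟩, rfl⟩
    exact Submodule.subset_span ⟨wordEmb K σ p, _, wordEmb K σ q, ⟨w, hw, rfl⟩, by simp⟩

theorem wordSpan_inj (K : Type*) [Field K] (σ : Type*) (W W' : Set (FreeMonoid σ)) :
    Submodule.span K (wordEmb K σ '' W) = Submodule.span K (wordEmb K σ '' W') ↔ W = W' := by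
  constructor
  · intro h; ext w
    rw [← wordEmb_mem_wordSpan K σ W, h, wordEmb_mem_wordSpan]
  · rintro rfl; rfl

theorem coeffw_mul_word (K : Type*) [Field K] (σ : Type*) (p q : FreeMonoid σ)
    (x : FreeAlgebra K σ) :
    coeffw K σ (wordEmb K σ p * x * wordEmb K σ q) =
      Finsupp.mapDomain (fun w => p * w * q) (coeffw K σ x) := by
  induction mem_top_wordSpan K σ x using Submodule.span_induction with
  | mem y hy =>
    obtain ⟨w, -, rfl⟩ := hy
    rw [← map_mul, ← map_mul, coeffw_wordEmb, coeffw_wordEmb, Finsupp.mapDomain_single]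
  | zero => simp [coeffw]
  | add y z _ _ hy hz =>
    rw [mul_add, add_mul]
    unfold coeffw at *
    rw [map_add, map_add, hy, hz, Finsupp.mapDomain_add]
  | smul c y _ hy =>
    rw [mul_smul_comm, smul_mul_assoc]
    unfold coeffw at *
    rw [map_smul, map_smul, hy, Finsupp.mapDomain_smul]

theorem mulWord_injective {σ : Type*} (p q : FreeMonoid σ) :
    Function.Injective (fun w : FreeMonoid σ => p * w * q) := by
  intro a b h
  exact mul_left_cancel (mul_right_cancel h)

theorem coeffw_mul_word_apply (K : Type*) [Field K] (σ : Type*) (p q w : FreeMonoid σ)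
    (x : FreeAlgebra K σ) :
    coeffw K σ (wordEmb K σ p * x * wordEmb K σ q) (p * w * q) = coeffw K σ x w := by
  rw [coeffw_mul_word]
  exact Finsupp.mapDomain_apply (mulWord_injective p q) _ _

theorem coeffw_mul_word_ne (K : Type*) [Field K] (σ : Type*) (p q u : FreeMonoid σ)
    (x : FreeAlgebra K σ) (h : coeffw K σ (wordEmb K σ p * x * wordEmb K σ q) u ≠ 0) :
    ∃ w, u = p * w * q ∧ coeffw K σ x w ≠ 0 := by
  by_cases hu : u ∈ Set.range (fun w => p * w * q)
  · obtain ⟨w, rfl⟩ := hu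
    exact ⟨w, rfl, by rwa [← coeffw_mul_word_apply K σ p q w x]⟩
  · rw [coeffw_mul_word, Finsupp.mapDomain_notin_range _ _ hu] at h
    exact absurd rfl h

theorem factClosure_tip {K : Type*} [Field K] {σ : Type*}
    {lt : FreeMonoid σ → FreeMonoid σ → Prop} (hlt : IsAdmissibleOrder lt)
    {I : Submodule K (FreeAlgebra K σ)} (hI : IsIdeal2 K σ I) :
    factClosure (tipSet K lt (I : Set (FreeAlgebra K σ))) = tipSet K lt (I : Set _) := by
  ext w
  constructor
  · rintro ⟨t, ⟨x, hx, h1, h2⟩, p, q, rfl⟩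
    refine ⟨_, hI (wordEmb K σ p) (wordEmb K σ q) x hx, ?_, ?_⟩
    · rwa [coeffw_mul_word_apply]
    · intro u hu
      obtain ⟨v, rfl, hv⟩ := coeffw_mul_word_ne K σ p q u x hu
      rcases h2 v hv with rfl | h
      · exact Or.inl rfl
      · exact Or.inr (hlt.mul_right _ _ _ (hlt.mul_left _ _ _ h))
  · intro h
    exact ⟨w, h, 1, 1, by simp⟩

theorem exists_tip {K : Type*} [Field K] {σ : Type*}
    {lt : FreeMonoid σ → FreeMonoid σ → Prop} (hlt : IsAdmissibleOrder lt)
    {x : FreeAlgebra K σ} (hx : x ≠ 0) : ∃ t, IsTipOf K lt t x := by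
  classical
  haveI := hlt.isWellOrder
  letI := linearOrderOfSTO lt
  have hne : (coeffw K σ x).support.Nonempty := by
    rw [Finsupp.support_nonempty_iff]
    unfold coeffw
    simpa using hx
  obtain ⟨t, ht, hmax⟩ := (coeffw K σ x).support.exists_max_image id hne
  refine ⟨t, Finsupp.mem_support_iff.1 ht, fun u hu => ?_⟩
  have := hmax u (Finsupp.mem_support_iff.2 hu)
  rcases eq_or_lt_of_le this with h | h
  · exact Or.inl h
  · exact Or.inr h

theorem sup_nontip {K : Type*} [Field K] {σ : Type*}
    {lt : FreeMonoid σ → FreeMonoid σ → Prop} (hlt : IsAdmissibleOrder lt)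
    (I : Submodule K (FreeAlgebra K σ)) :
    I ⊔ Submodule.span K (wordEmb K σ '' nontipSet K lt (I : Set (FreeAlgebra K σ))) = ⊤ := by
  haveI := hlt.isWellOrder
  set M := I ⊔ Submodule.span K (wordEmb K σ '' nontipSet K lt (I : Set (FreeAlgebra K σ)))
  have key : ∀ w, wordEmb K σ w ∈ M := by
    intro w
    induction w using (IsWellFounded.wf (r := lt)).induction with
    | _ w ih =>
    by_cases hw : w ∈ nontipSet K lt (I : Set (FreeAlgebra K σ))
    · exact Submodule.mem_sup_right (Submodule.subset_span ⟨w, hw, rfl⟩)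
    · obtain ⟨x, hx, h1, h2⟩ := not_not.1 hw
      set c := coeffw K σ x w
      have hy : x - c • wordEmb K σ w ∈ Submodule.span K (wordEmb K σ '' {u | lt u w}) := by
        rw [mem_wordSpan]
        intro u hu
        have e : coeffw K σ (x - c • wordEmb K σ w) = coeffw K σ x - c • Finsupp.single w 1 := by
          rw [← coeffw_wordEmb K σ w]
          unfold coeffw
          rw [map_sub, map_smul]
        rw [e] at hu
        by_cases huw : u = w
        · subst huw
          simp [c] at hu
        · have : coeffw K σ x u ≠ 0 := by
            simpa [Finsupp.single_apply, Ne.symm huw] using hu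
          exact (h2 u this).resolve_left huw
      have hyM : x - c • wordEmb K σ w ∈ M := by
        refine (Submodule.span_le.2 ?_) hy
        rintro _ ⟨u, hu, rfl⟩
        exact ih u hu
      have : c • wordEmb K σ w ∈ M := by
        have := M.sub_mem (Submodule.mem_sup_left hx) hyM
        simpa using this
      exact (M.smul_mem_iff h1).1 this
  refine eq_top_iff.2 fun x _ => ?_
  refine (Submodule.span_le.2 ?_) (mem_top_wordSpan K σ x)
  rintro _ ⟨u, -, rfl⟩
  exact key u

theorem eq_zero_of_mem_nontip {K : Type*} [Field K] {σ : Type*}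
    {lt : FreeMonoid σ → FreeMonoid σ → Prop} (hlt : IsAdmissibleOrder lt)
    {I : Submodule K (FreeAlgebra K σ)} {x : FreeAlgebra K σ} (hx : x ∈ I)
    (h : ∀ w, coeffw K σ x w ≠ 0 → w ∈ nontipSet K lt (I : Set (FreeAlgebra K σ))) : x = 0 := by
  by_contra hne
  obtain ⟨t, ht⟩ := exists_tip hlt hne
  exact h t ht.1 ⟨x, hx, ht⟩

/-- Homogeneous component of degree `d`. -/
def homComp (K : Type*) [Field K] (σ : Type*) (d : ℕ) : FreeAlgebra K σ →ₗ[K] FreeAlgebra K σ :=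
  (FreeAlgebra.basisFreeMonoid K σ).constr K
    (fun w : FreeMonoid σ => if w.length = d then FreeAlgebra.basisFreeMonoid K σ w else 0)

theorem homComp_word (K : Type*) [Field K] (σ : Type*) (d : ℕ) (w : FreeMonoid σ) :
    homComp K σ d (wordEmb K σ w) = if w.length = d then wordEmb K σ w else 0 := by
  rw [wordEmb_eq_basis, homComp, Module.Basis.constr_basis]

theorem coeffw_homComp (K : Type*) [Field K] (σ : Type*) (d : ℕ) (x : FreeAlgebra K σ)
    (w : FreeMonoid σ) :
    coeffw K σ (homComp K σ d x) w = if w.length = d then coeffw K σ x w else 0 := by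
  classical
  induction mem_top_wordSpan K σ x using Submodule.span_induction with
  | mem y hy =>
    obtain ⟨u, -, rfl⟩ := hy
    rw [homComp_word, coeffw_wordEmb]
    by_cases e : u = w
    · subst e
      split_ifs
      · rw [coeffw_wordEmb]
      · simp [coeffw]
    · have hz : coeffw K σ (wordEmb K σ u) w = 0 := by
        rw [coeffw_wordEmb]
        exact Finsupp.single_eq_of_ne (Ne.symm e)
      rw [← coeffw_wordEmb, hz, ite_self]
      split_ifs
      · exact hz
      · simp [coeffw]
  | zero => simp [coeffw]
  | add y z _ _ hy hz =>
    unfold coeffw at *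
    rw [map_add, map_add, map_add, Finsupp.add_apply, hy, hz]
    split_ifs <;> simp
  | smul c y _ hy =>
    unfold coeffw at *
    rw [map_smul, map_smul, map_smul, Finsupp.smul_apply, hy]
    split_ifs <;> simp

theorem ext_coeffw {K : Type*} [Field K] {σ : Type*} {x y : FreeAlgebra K σ}
    (h : ∀ w, coeffw K σ x w = coeffw K σ y w) : x = y :=
  (FreeAlgebra.basisFreeMonoid K σ).repr.injective (Finsupp.ext h)

theorem homComp_mem (K : Type*) [Field K] (σ : Type*) (S : Set (FreeAlgebra K σ))
    (hS : ∀ s ∈ S, ∃ d, IsHomogOfDeg K s d) (d : ℕ) {x : FreeAlgebra K σ}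
    (hx : x ∈ idealGen K σ S) : homComp K σ d x ∈ idealGen K σ S := by
  have : idealGen K σ S ≤ (idealGen K σ S).comap (homComp K σ d) := by
    refine Submodule.span_le.2 ?_
    rintro _ ⟨a, s, b, hs, rfl⟩
    refine mul_mem_of_words K σ _ _ (fun p q => ?_) a b
    obtain ⟨e, he⟩ := hS s hs
    have hlen : ∀ w, coeffw K σ (wordEmb K σ p * s * wordEmb K σ q) w ≠ 0 →
        w.length = p.length + e + q.length := by
      intro w hw
      obtain ⟨v, rfl, hv⟩ := coeffw_mul_word_ne K σ p q w s hw
      rw [FreeMonoid.length_mul, FreeMonoid.length_mul, he v hv]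
    rw [Submodule.mem_comap]
    by_cases hd : p.length + e + q.length = d
    · have : homComp K σ d (wordEmb K σ p * s * wordEmb K σ q)
          = wordEmb K σ p * s * wordEmb K σ q := by
        refine ext_coeffw fun w => ?_
        rw [coeffw_homComp]
        split_ifs with h
        · rfl
        · by_contra hne
          exact h ((hlen w (Ne.symm hne)).trans hd)
      rw [this]
      exact Submodule.subset_span ⟨_, _, _, hs, rfl⟩
    · have : homComp K σ d (wordEmb K σ p * s * wordEmb K σ q) = 0 := by
        refine ext_coeffw fun w => ?_
        rw [coeffw_homComp]
        split_ifs with h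
        · by_contra hne
          refine hd ((hlen w ?_).symm.trans h)
          simpa [coeffw] using hne
        · simp [coeffw]
      rw [this]
      exact Submodule.zero_mem _
  exact this hx

/-- for `T` a set of words of length 2 and `I` generated by homogeneous elements:
`⟨tip I⟩ = ⟨T⟩` iff `nontip I = N`, and in that case the images of `N` form a basis of `A/I` and
the reduced Gröbner basis is quadratic, so `A/I` is strong Koszul. -/
theorem stmt10 (K : Type*) [Field K] (σ : Type*)
    (lt : FreeMonoid σ → FreeMonoid σ → Prop) (hlt : IsLengthAdmissibleOrder lt)
    (T : Set (FreeMonoid σ)) (hT2 : ∀ t ∈ T, t.length = 2)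
    (N : Set (FreeMonoid σ)) (hN : N = {w | ¬ ∃ t ∈ T, ∃ p q : FreeMonoid σ, w = p * t * q})
    (I : Submodule K (FreeAlgebra K σ)) (hI : IsIdeal2 K σ I)
    (hgen : ∃ S : Set (FreeAlgebra K σ),
      (∀ s ∈ S, ∃ d, IsHomogOfDeg K s d) ∧ I = idealGen K σ S) :
    (idealGen K σ (wordEmb K σ '' tipSet K lt (I : Set (FreeAlgebra K σ)))
        = idealGen K σ (wordEmb K σ '' T)
      ↔ nontipSet K lt (I : Set (FreeAlgebra K σ)) = N) ∧
    (idealGen K σ (wordEmb K σ '' tipSet K lt (I : Set (FreeAlgebra K σ)))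
        = idealGen K σ (wordEmb K σ '' T) →
      (LinearIndependent K (fun n : N => I.mkQ (wordEmb K σ n)) ∧
        Submodule.span K (Set.range (fun n : N => I.mkQ (wordEmb K σ n))) = ⊤) ∧
      (∀ t ∈ T, ∀ g ∈ I,
        wordEmb K σ t - g ∈
          Submodule.span K (wordEmb K σ '' nontipSet K lt (I : Set (FreeAlgebra K σ))) →
        IsHomogOfDeg K g 2) ∧
      (∃ G : Set (FreeAlgebra K σ), (∀ x ∈ G, IsHomogOfDeg K x 2) ∧
        IsGrobnerBasis K lt G I)) := by
  have hadm := hlt.toIsAdmissibleOrder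
  have hiff : idealGen K σ (wordEmb K σ '' tipSet K lt (I : Set (FreeAlgebra K σ)))
        = idealGen K σ (wordEmb K σ '' T)
      ↔ nontipSet K lt (I : Set (FreeAlgebra K σ)) = N := by
    rw [idealGen_words, idealGen_words, wordSpan_inj, factClosure_tip hadm hI, hN]
    exact compl_inj_iff.symm
  refine ⟨hiff, fun hTip => ?_⟩
  have hNT := hiff.1 hTip
  obtain ⟨S, hS, hIS⟩ := hgen
  have hcomp : ∀ d, ∀ x ∈ I, homComp K σ d x ∈ I := by
    intro d x hx
    rw [hIS] at hx ⊢
    exact homComp_mem K σ S hS d hx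
  have htipT : ∀ t ∈ T, t ∈ tipSet K lt (I : Set (FreeAlgebra K σ)) := by
    intro t ht
    by_contra h
    have h' : t ∈ N := hNT ▸ h
    rw [hN] at h'
    exact h' ⟨t, ht, 1, 1, by simp⟩
  refine ⟨⟨?_, ?_⟩, ?_, ?_⟩
  · have hli : LinearIndependent K (fun n : N => wordEmb K σ n) := by
      have := (FreeAlgebra.basisFreeMonoid K σ).linearIndependent.comp
        (Subtype.val : N → FreeMonoid σ) Subtype.val_injective
      have e : (fun n : N => wordEmb K σ n)
          = (FreeAlgebra.basisFreeMonoid K σ) ∘ (Subtype.val : N → FreeMonoid σ) := by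
        funext n
        exact wordEmb_eq_basis K σ n
      rw [e]
      exact this
    refine hli.map (f := I.mkQ) ?_
    rw [Submodule.ker_mkQ, Submodule.disjoint_def]
    intro x hx hxI
    refine eq_zero_of_mem_nontip hadm hxI ?_
    rw [hNT, ← mem_wordSpan]
    rwa [Set.image_eq_range]
  · have h := sup_nontip hadm I
    rw [hNT] at h
    have h2 := congrArg (Submodule.map I.mkQ) h
    rw [Submodule.map_sup, Submodule.map_span, Submodule.map_top, Submodule.range_mkQ,
      Submodule.mkQ_map_self, bot_sup_eq, ← Set.image_comp, Set.image_eq_range] at h2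
    exact h2
  · intro t ht g hg hspan w hw
    by_contra hlen
    have hz : homComp K σ w.length g = 0 := by
      refine eq_zero_of_mem_nontip hadm (hcomp _ g hg) fun u hu => ?_
      rw [coeffw_homComp] at hu
      split_ifs at hu with hul
      · refine (mem_wordSpan K σ _ _).1 hspan u ?_
        have e : coeffw K σ (wordEmb K σ t - g) = Finsupp.single t 1 - coeffw K σ g := by
          rw [← coeffw_wordEmb K σ t]
          unfold coeffw
          rw [map_sub]
        have htu : t ≠ u := by
          rintro rfl
          exact hlen (hul ▸ hT2 t ht)
        rw [e, Finsupp.sub_apply, Finsupp.single_eq_of_ne (Ne.symm htu), zero_sub]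
        exact neg_ne_zero.2 hu
      · exact absurd rfl hu
    have := coeffw_homComp K σ w.length g w
    rw [hz, if_pos rfl] at this
    exact hw (by rw [← this]; simp [coeffw])
  · refine ⟨{x | x ∈ I ∧ IsHomogOfDeg K x 2}, fun x hx => hx.2, fun x hx => hx.1, ?_⟩
    rw [idealGen_words, idealGen_words, wordSpan_inj]
    rw [idealGen_words, idealGen_words, wordSpan_inj] at hTip
    apply Set.Subset.antisymm
    · rintro _ ⟨t, ⟨x, hx, htx⟩, p, q, rfl⟩
      exact ⟨t, ⟨x, hx.1, htx⟩, p, q, rfl⟩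
    · rw [hTip]
      rintro _ ⟨t, ht, p, q, rfl⟩
      refine ⟨t, ?_, p, q, rfl⟩
      obtain ⟨x, hx, h1, h2⟩ := htipT t ht
      refine ⟨homComp K σ 2 x, ⟨hcomp 2 x hx, ?_⟩, ?_, ?_⟩
      · intro w hw
        rw [coeffw_homComp] at hw
        by_contra h
        exact hw (if_neg h)
      · rwa [coeffw_homComp, if_pos (hT2 t ht)]
      · intro u hu
        rw [coeffw_homComp] at hu
        split_ifs at hu
        · exact h2 u hu
        · exact absurd rfl hu
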